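/- arXiv:1602.06133 — 6 statements merged into one kernel-verified Lean document; each statement's English description precedes it below -/
import Mathlib

section
/- Let h, g be nonzero vectors in EuclideanSpace ℂ (Fin n) and let ε > 0 be a real number with ε·‖h‖² < ‖⟪g,h⟫‖² (so that the maximum-ratio beamformer is infeasible). Suppose w* ∈ EuclideanSpace ℂ (Fin n) satisfies ‖w*‖ ≤ 1 and ‖⟪g,w*⟫‖² ≤ ε, and ‖⟪h,w⟫‖² ≤ ‖⟪h,w*⟫‖² for every w with ‖w‖ ≤ 1 and ‖⟪g,w⟫‖² ≤ ε. Then ‖⟪g,w*⟫‖² = ε. -/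
open scoped InnerProductSpace

local notation "⟪" x ", " y "⟫" => @inner ℂ _ _ x y

theorem SI_constraint_active {n : ℕ} (h g : EuclideanSpace ℂ (Fin n))
    (hh : h ≠ 0) (hg : g ≠ 0)
    (ε : ℝ) (hε : 0 < ε) (hinfeas : ε * ‖h‖ ^ 2 < ‖⟪g, h⟫‖ ^ 2)
    (wstar : EuclideanSpace ℂ (Fin n))
    (hnorm : ‖wstar‖ ≤ 1) (hSI : ‖⟪g, wstar⟫‖ ^ 2 ≤ ε)
    (hopt : ∀ w : EuclideanSpace ℂ (Fin n), ‖w‖ ≤ 1 → ‖⟪g, w⟫‖ ^ 2 ≤ ε →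
      ‖⟪h, w⟫‖ ^ 2 ≤ ‖⟪h, wstar⟫‖ ^ 2) :
    ‖⟪g, wstar⟫‖ ^ 2 = ε := by
  by_contra hne
  have hlt : ‖⟪g, wstar⟫‖ ^ 2 < ε := lt_of_le_of_ne hSI hne
  have hpos : 0 < ‖h‖ := norm_pos_iff.mpr hh
  obtain ⟨a, ha⟩ : ∃ a : ℂ, a = ⟪h, wstar⟫ := ⟨_, rfl⟩
  obtain ⟨c, hc1, hc⟩ : ∃ c : ℂ, ‖c‖ = 1 ∧ a = (‖a‖ : ℂ) * c := by
    by_cases h0 : a = 0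
    · exact ⟨1, by simp, by simp [h0]⟩
    · have h1 : (‖a‖ : ℂ) ≠ 0 := by simpa using h0
      refine ⟨a / (‖a‖ : ℂ), ?_, ?_⟩
      · simp [h0]
      · field_simp
  obtain ⟨u, hu⟩ : ∃ u : EuclideanSpace ℂ (Fin n), u = (c / (‖h‖ : ℂ)) • h := ⟨_, rfl⟩
  have hun : ‖u‖ = 1 := by
    rw [hu, norm_smul, norm_div, hc1]
    simp [hpos.ne']
  have hhu : ⟪h, u⟫ = (‖h‖ : ℂ) * c := by
    have : (‖h‖ : ℂ) ≠ 0 := by simpa using hh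
    rw [hu, inner_smul_right, inner_self_eq_norm_sq_to_K]
    simp only [Complex.coe_algebraMap]
    field_simp
  have hcont : Continuous fun t : ℝ =>
      ‖⟪g, ((1 - t : ℝ) : ℂ) • wstar + (t : ℂ) • u⟫‖ ^ 2 := by
    fun_prop
  have hev : ∀ᶠ t : ℝ in nhds 0,
      ‖⟪g, ((1 - t : ℝ) : ℂ) • wstar + (t : ℂ) • u⟫‖ ^ 2 < ε := by
    apply hcont.continuousAt.eventually_lt continuousAt_const
    simpa using hlt
  obtain ⟨δ, hδ, hball⟩ := Metric.eventually_nhds_iff.mp hev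
  obtain ⟨t, ht0, ht1, htδ⟩ : ∃ t : ℝ, 0 < t ∧ t < 1 ∧ t < δ := by
    have : 0 < min 1 δ := lt_min one_pos hδ
    exact ⟨min 1 δ / 2, by positivity, by linarith [min_le_left 1 δ],
      by linarith [min_le_right 1 δ]⟩
  have hf := hball (y := t) (by simpa [abs_of_pos ht0] using htδ)
  have hn : ‖((1 - t : ℝ) : ℂ) • wstar + (t : ℂ) • u‖ ≤ 1 := by
    refine (norm_add_le _ _).trans ?_
    rw [norm_smul, norm_smul, hun, Complex.norm_real, Complex.norm_real, Real.norm_eq_abs,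
      Real.norm_eq_abs, abs_of_pos ht0, abs_of_pos (by linarith)]
    nlinarith
  have ho := hopt _ hn hf.le
  have e : ⟪h, ((1 - t : ℝ) : ℂ) • wstar + (t : ℂ) • u⟫
      = (((1 - t) * ‖a‖ + t * ‖h‖ : ℝ) : ℂ) * c := by
    rw [inner_add_right, inner_smul_right, inner_smul_right, hhu, ← ha]
    conv_lhs => rw [hc]
    push_cast
    ring
  rw [e, ← ha, norm_mul, hc1, mul_one, Complex.norm_real, Real.norm_eq_abs, sq_abs] at ho
  have ho2 := abs_le_of_sq_le_sq ho (norm_nonneg a)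
  have hle : ‖h‖ ≤ ‖a‖ := by
    have := (abs_le.mp ho2).2
    nlinarith
  have hcs : ‖a‖ ≤ ‖h‖ * ‖wstar‖ := by rw [ha]; exact norm_inner_le_norm h wstar
  have hw1 : ‖wstar‖ = 1 := by
    apply le_antisymm hnorm
    by_contra hcon
    nlinarith
  have heq : ‖⟪h, wstar⟫‖ = ‖h‖ * ‖wstar‖ := by
    rw [← ha]; apply le_antisymm hcs; rw [hw1, mul_one]; exact hle
  have hw0 : wstar ≠ 0 := by
    rw [← norm_pos_iff, hw1]; exact one_pos
  obtain ⟨r, hr0, hr⟩ := (norm_inner_eq_norm_iff hh hw0).mp heq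
  have h1 : ‖r‖ * ‖h‖ = 1 := by rw [← norm_smul, ← hr, hw1]
  have hrp : 0 < ‖r‖ := norm_pos_iff.mpr hr0
  rw [hr, inner_smul_right, norm_mul, mul_pow] at hlt
  have h2 := mul_lt_mul_of_pos_left hinfeas (pow_pos hrp 2)
  have h3 : ‖r‖ ^ 2 * (ε * ‖h‖ ^ 2) = ε := by
    calc _ = ε * (‖r‖ * ‖h‖) ^ 2 := by ring
      _ = ε := by rw [h1]; ring
  linarith
end

section
/- Let h, g be linearly independent vectors in EuclideanSpace ℂ (Fin n) with g ≠ 0, and for α ∈ ℝ define u(α) := h - α·(⟪g,h⟫/‖g‖²)·g and w(α) := ‖u(α)‖⁻¹ • u(α). Then for all real α₁, α₂ with 0 ≤ α₁ ≤ α₂ ≤ 1, one has ‖⟪g, w(α₂)⟫‖² ≤ ‖⟪g, w(α₁)⟫‖². -/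
open scoped InnerProductSpace

local notation "⟪" x ", " y "⟫" => @inner ℂ _ _ x y

theorem SI_power_monotone {n : ℕ} (h g : EuclideanSpace ℂ (Fin n))
    (hind : LinearIndependent ℂ ![h, g]) (hg : g ≠ 0)
    (u w : ℝ → EuclideanSpace ℂ (Fin n))
    (hu : ∀ α : ℝ, u α = h - ((α : ℂ) * (⟪g, h⟫ / ((‖g‖ : ℂ) ^ 2))) • g)
    (hw : ∀ α : ℝ, w α = ‖u α‖⁻¹ • u α) :
    ∀ α₁ α₂ : ℝ, 0 ≤ α₁ → α₁ ≤ α₂ → α₂ ≤ 1 →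
      ‖⟪g, w α₂⟫‖ ^ 2 ≤ ‖⟪g, w α₁⟫‖ ^ 2 := by
  have hG : (0:ℝ) < ‖g‖ := norm_pos_iff.mpr hg
  have hGc : (‖g‖ : ℂ) ≠ 0 := by exact_mod_cast hG.ne'
  have hgg : ⟪g, g⟫ = (‖g‖ : ℂ) ^ 2 := inner_self_eq_norm_sq_to_K g
  have hin : ∀ α : ℝ, ⟪g, u α⟫ = ((1 - α : ℝ) : ℂ) * ⟪g, h⟫ := by
    intro α
    rw [hu, inner_sub_right, inner_smul_right, hgg]
    push_cast
    field_simp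
  have hne : u 1 ≠ 0 := by
    intro h0
    rw [LinearIndependent.pair_iff] at hind
    have := hind 1 (-(((1:ℝ) : ℂ) * (⟪g, h⟫ / ((‖g‖ : ℂ) ^ 2)))) (by
      rw [one_smul, neg_smul, ← sub_eq_add_neg, ← hu, h0])
    exact one_ne_zero this.1
  have hP : 0 < ‖u 1‖ ^ 2 := by
    have := norm_pos_iff.mpr hne
    positivity
  have hdec : ∀ α : ℝ, u α = u 1 + (((1 - α : ℝ) : ℂ) * (⟪g, h⟫ / ((‖g‖ : ℂ) ^ 2))) • g := by
    intro α
    rw [hu α, hu 1]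
    push_cast
    module
  have hort : ⟪u 1, g⟫ = 0 := by
    rw [inner_eq_zero_symm, hin]; simp
  have hnorm : ∀ α : ℝ, ‖u α‖ ^ 2 = ‖u 1‖ ^ 2 + (1 - α) ^ 2 * (‖⟪g, h⟫‖ ^ 2 / ‖g‖ ^ 2) := by
    intro α
    rw [hdec α, norm_add_sq (𝕜 := ℂ), inner_smul_right, hort, norm_smul, norm_mul, norm_div,
      norm_pow, Complex.norm_real, Complex.norm_real, norm_norm, mul_pow, mul_pow,
      Real.norm_eq_abs, sq_abs]
    simp only [mul_zero, map_zero, add_zero]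
    field_simp
  have hval : ∀ α : ℝ, ‖⟪g, w α⟫‖ ^ 2 = ((1 - α) ^ 2 * ‖⟪g, h⟫‖ ^ 2) /
      (‖u 1‖ ^ 2 + (1 - α) ^ 2 * (‖⟪g, h⟫‖ ^ 2 / ‖g‖ ^ 2)) := by
    intro α
    rw [← hnorm, hw, ← Complex.coe_smul, inner_smul_right, hin, norm_mul, norm_mul,
      Complex.norm_real, Complex.norm_real, mul_pow, mul_pow, Real.norm_eq_abs,
      Real.norm_eq_abs, sq_abs, sq_abs, inv_pow]
    ring
  intro a b ha hab hb
  rw [hval, hval]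
  have hsq : (1 - b) ^ 2 ≤ (1 - a) ^ 2 := by nlinarith
  generalize ‖u 1‖ ^ 2 = P at *
  have hC : 0 ≤ ‖⟪g, h⟫‖ ^ 2 := by positivity
  have hD : 0 ≤ ‖⟪g, h⟫‖ ^ 2 / ‖g‖ ^ 2 := by positivity
  generalize ‖⟪g, h⟫‖ ^ 2 / ‖g‖ ^ 2 = D at *
  generalize ‖⟪g, h⟫‖ ^ 2 = C at *
  rw [div_le_div_iff₀ (by positivity) (by positivity)]
  nlinarith [mul_le_mul_of_nonneg_right hsq (mul_nonneg hC hP.le)]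
end

section
/- Let h, g be linearly independent vectors in EuclideanSpace ℂ (Fin n) with g ≠ 0, and for α ∈ ℝ define u(α) := h - α·(⟪g,h⟫/‖g‖²)·g and w(α) := ‖u(α)‖⁻¹ • u(α). Then for all real α₁, α₂ with 0 ≤ α₁ ≤ α₂ ≤ 1, one has ‖⟪h, w(α₂)⟫‖² ≤ ‖⟪h, w(α₁)⟫‖². -/
open scoped InnerProductSpace

local notation "⟪" x ", " y "⟫" => @inner ℂ _ _ x y

theorem downlink_power_monotone {n : ℕ} (h g : EuclideanSpace ℂ (Fin n))
    (hind : LinearIndependent ℂ ![h, g]) (hg : g ≠ 0)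
    (u w : ℝ → EuclideanSpace ℂ (Fin n))
    (hu : ∀ α : ℝ, u α = h - ((α : ℂ) * (⟪g, h⟫ / ((‖g‖ : ℂ) ^ 2))) • g)
    (hw : ∀ α : ℝ, w α = ‖u α‖⁻¹ • u α) :
    ∀ α₁ α₂ : ℝ, 0 ≤ α₁ → α₁ ≤ α₂ → α₂ ≤ 1 →
      ‖⟪h, w α₂⟫‖ ^ 2 ≤ ‖⟪h, w α₁⟫‖ ^ 2 := by
  have hG : 0 < ‖g‖ := norm_pos_iff.mpr hg
  obtain ⟨C, hC⟩ : ∃ C : ℝ, C = ‖⟪g, h⟫‖ ^ 2 / ‖g‖ ^ 2 := ⟨_, rfl⟩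
  obtain ⟨B, hB⟩ : ∃ B : ℝ, B = ‖h‖ ^ 2 - C := ⟨_, rfl⟩
  have hC0 : 0 ≤ C := by rw [hC]; positivity
  have hk : ∀ α : ℝ, ⟪h, ((α : ℂ) * (⟪g, h⟫ / ((‖g‖ : ℂ) ^ 2))) • g⟫ = ((α * C : ℝ) : ℂ) := by
    intro α
    have h1 : ⟪g, h⟫ * ⟪h, g⟫ = ((‖⟪g, h⟫‖ : ℂ)) ^ 2 := by
      rw [← inner_conj_symm h g, Complex.mul_conj, Complex.normSq_eq_norm_sq]
      push_cast; rfl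
    rw [inner_smul_right, hC]
    push_cast
    rw [← h1]; ring
  have hin : ∀ α : ℝ, ⟪h, u α⟫ = ((B + (1 - α) * C : ℝ) : ℂ) := by
    intro α
    rw [hu, inner_sub_right, hk, inner_self_eq_norm_sq_to_K, hB]
    push_cast
    simp only [Complex.coe_algebraMap]
    ring
  have hn : ∀ α : ℝ, ‖u α‖ ^ 2 = B + (1 - α) ^ 2 * C := by
    intro α
    rw [hu, norm_sub_sq (𝕜 := ℂ), hk, norm_smul, norm_mul, norm_div, norm_pow, hB]
    have : (‖(α : ℂ)‖ * (‖⟪g, h⟫‖ / ‖(‖g‖ : ℂ)‖ ^ 2) * ‖g‖) ^ 2 = α ^ 2 * C := by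
      rw [hC]
      simp only [Complex.norm_real, norm_norm, Real.norm_eq_abs, mul_pow, sq_abs, abs_norm]
      field_simp
    rw [this]
    simp only [RCLike.re_to_complex, Complex.ofReal_re]
    ring
  have hB0 : 0 < B := by
    have h1 := hn 1
    have h2 : u 1 ≠ 0 := by
      intro h0
      rw [hu] at h0
      rw [LinearIndependent.pair_iff] at hind
      have := hind 1 (-(((1 : ℝ) : ℂ) * (⟪g, h⟫ / ((‖g‖ : ℂ) ^ 2))))
        (by rw [neg_smul, one_smul, ← sub_eq_add_neg]; exact h0)
      exact one_ne_zero this.1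
    have := pow_pos (norm_pos_iff.mpr h2) 2
    nlinarith
  have hf : ∀ α : ℝ, ‖⟪h, w α⟫‖ ^ 2 = (B + (1 - α) * C) ^ 2 / (B + (1 - α) ^ 2 * C) := by
    intro α
    have : ⟪h, w α⟫ = ((‖u α‖⁻¹ : ℝ) : ℂ) * ⟪h, u α⟫ := by
      rw [hw, ← inner_smul_right, Complex.coe_smul]
    rw [this, hin, norm_mul, Complex.norm_real, Complex.norm_real, mul_pow, Real.norm_eq_abs,
      Real.norm_eq_abs, sq_abs, sq_abs, inv_pow, hn]
    ring
  intro a b ha hab hb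
  rw [hf, hf, div_le_div_iff₀ (by positivity) (by positivity)]
  obtain ⟨s, hs⟩ : ∃ s, s = 1 - b := ⟨_, rfl⟩
  obtain ⟨t, ht⟩ : ∃ t, t = 1 - a := ⟨_, rfl⟩
  rw [← hs, ← ht]
  have e1 : 0 ≤ t - s := by linarith
  have e2 : 0 ≤ 2 - s - t := by linarith
  have e3 : 0 ≤ s + t - 2 * t * s := by
    have := mul_nonneg (show 0 ≤ s by linarith) (show 0 ≤ 1 - t by linarith)
    have := mul_nonneg (show 0 ≤ t by linarith) (show 0 ≤ 1 - s by linarith)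
    linarith
  have : 0 ≤ B * C * (t - s) * (B * (2 - s - t) + C * (s + t - 2 * t * s)) := by positivity
  linarith
end

section
/- Let h, g be linearly independent vectors in EuclideanSpace ℂ (Fin n) with g ≠ 0 and ⟪g,h⟫ ≠ 0, and let ε be a real number with 0 < ε < ‖g‖². Define ζ := (1 - ε/‖g‖²)·‖⟪g,h⟫‖², η := ‖⟪g,h⟫‖² - ε·‖h‖², and α̃ := 1 - Real.sqrt ((ζ - η)/ζ). Let u := h - α̃·(⟪g,h⟫/‖g‖²)·g and w̃ := ‖u‖⁻¹ • u. Then ‖⟪g, w̃⟫‖² = ε. -/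
open scoped InnerProductSpace

local notation "⟪" x ", " y "⟫" => @inner ℂ _ _ x y

theorem SI_equality_at_alpha_tilde {n : ℕ} (h g : EuclideanSpace ℂ (Fin n))
    (hind : LinearIndependent ℂ ![h, g]) (hg : g ≠ 0) (hgh : ⟪g, h⟫ ≠ 0)
    (ε : ℝ) (hε : 0 < ε) (hε' : ε < ‖g‖ ^ 2)
    (ζ η αtilde : ℝ)
    (hζ : ζ = (1 - ε / ‖g‖ ^ 2) * ‖⟪g, h⟫‖ ^ 2)
    (hη : η = ‖⟪g, h⟫‖ ^ 2 - ε * ‖h‖ ^ 2)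
    (hα : αtilde = 1 - Real.sqrt ((ζ - η) / ζ))
    (u wtilde : EuclideanSpace ℂ (Fin n))
    (hu : u = h - ((αtilde : ℂ) * (⟪g, h⟫ / ((‖g‖ : ℂ) ^ 2))) • g)
    (hw : wtilde = ‖u‖⁻¹ • u) :
    ‖⟪g, wtilde⟫‖ ^ 2 = ε := by
  have hG : 0 < ‖g‖ ^ 2 := by positivity
  have hC : 0 < ‖⟪g, h⟫‖ ^ 2 := by positivity
  have hu0 : u ≠ 0 := by
    intro h0
    rw [LinearIndependent.pair_iff] at hind
    have h1 := hind 1 (-((αtilde : ℂ) * (⟪g, h⟫ / ((‖g‖ : ℂ) ^ 2)))) (by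
      rw [one_smul, neg_smul, ← sub_eq_add_neg, ← hu, h0])
    exact one_ne_zero h1.1
  have hgc : ((‖g‖ : ℂ)) ≠ 0 := by
    simpa using hg
  have hin : ⟪g, u⟫ = ((1 - αtilde : ℝ) : ℂ) * ⟪g, h⟫ := by
    rw [hu, inner_sub_right, inner_smul_right, inner_self_eq_norm_sq_to_K]
    push_cast
    simp only [Complex.coe_algebraMap]
    field_simp
  have hin2 : ‖⟪g, u⟫‖ ^ 2 = (1 - αtilde) ^ 2 * ‖⟪g, h⟫‖ ^ 2 := by
    rw [hin, norm_mul, mul_pow, Complex.norm_real, Real.norm_eq_abs, sq_abs]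
  have hun : ‖u‖ ^ 2 = ‖h‖ ^ 2 - 2 * (αtilde * ‖⟪g, h⟫‖ ^ 2 / ‖g‖ ^ 2)
      + αtilde ^ 2 * ‖⟪g, h⟫‖ ^ 2 / ‖g‖ ^ 2 := by
    have e1 : ⟪h, ((αtilde : ℂ) * (⟪g, h⟫ / ((‖g‖ : ℂ) ^ 2))) • g⟫
        = ((αtilde * ‖⟪g, h⟫‖ ^ 2 / ‖g‖ ^ 2 : ℝ) : ℂ) := by
      rw [inner_smul_right, ← inner_conj_symm h g]
      push_cast
      rw [← Complex.mul_conj']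
      ring
    rw [hu, norm_sub_sq (𝕜 := ℂ), e1, norm_smul, norm_mul, norm_div, norm_pow,
      Complex.norm_real, Complex.norm_real, norm_norm, Real.norm_eq_abs, mul_pow, mul_pow, sq_abs]
    simp only [RCLike.re_to_complex, Complex.ofReal_re]
    field_simp
  have hCS : ‖⟪g, h⟫‖ ^ 2 ≤ ‖g‖ ^ 2 * ‖h‖ ^ 2 := by
    rw [← mul_pow]
    exact pow_le_pow_left₀ (norm_nonneg _) (norm_inner_le_norm g h) 2
  have hζ0 : 0 < ζ := by
    rw [hζ]
    have : ε / ‖g‖ ^ 2 < 1 := (div_lt_one hG).2 hε'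
    exact mul_pos (by linarith) hC
  have hd : 0 ≤ ζ - η := by
    have e : ζ - η = ε * (‖h‖ ^ 2 - ‖⟪g, h⟫‖ ^ 2 / ‖g‖ ^ 2) := by
      rw [hζ, hη]; ring
    rw [e]
    apply mul_nonneg hε.le
    rw [sub_nonneg, div_le_iff₀ hG]
    linarith
  have hs : (1 - αtilde) ^ 2 * ζ = ζ - η := by
    rw [hα, sub_sub_cancel, Real.sq_sqrt (div_nonneg hd hζ0.le)]
    field_simp
  have hun0 : ‖u‖ ^ 2 ≠ 0 := by simpa using hu0
  have key : ‖⟪g, u⟫‖ ^ 2 = ε * ‖u‖ ^ 2 := by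
    rw [hin2, hun]
    rw [hη, hζ] at hs
    linear_combination hs
  have hw2 : ‖⟪g, wtilde⟫‖ ^ 2 = (‖u‖ ^ 2)⁻¹ * ‖⟪g, u⟫‖ ^ 2 := by
    rw [hw, inner_smul_right_eq_smul, norm_smul, norm_inv, norm_norm, mul_pow, inv_pow]
  rw [hw2, key]
  field_simp
end

section
/- Let h, g be linearly independent vectors in EuclideanSpace ℂ (Fin n) with g ≠ 0 and ⟪g,h⟫ ≠ 0, and let ε be a real number with 0 < ε < ‖g‖². Define ζ := (1 - ε/‖g‖²)·‖⟪g,h⟫‖² and η := ‖⟪g,h⟫‖² - ε·‖h‖². Then for every real α, with u(α) := h - α·(⟪g,h⟫/‖g‖²)·g and w(α) := ‖u(α)‖⁻¹ • u(α), the equation ‖⟪g, w(α)⟫‖² = ε holds if and only if ζ·(1-α)² = ζ - η. -/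
open scoped InnerProductSpace

local notation "⟪" x ", " y "⟫" => @inner ℂ _ _ x y

theorem SI_equality_iff_quadratic {n : ℕ} (h g : EuclideanSpace ℂ (Fin n))
    (hind : LinearIndependent ℂ ![h, g]) (hg : g ≠ 0) (hgh : ⟪g, h⟫ ≠ 0)
    (ε : ℝ) (hε : 0 < ε) (hε' : ε < ‖g‖ ^ 2)
    (ζ η : ℝ)
    (hζ : ζ = (1 - ε / ‖g‖ ^ 2) * ‖⟪g, h⟫‖ ^ 2)
    (hη : η = ‖⟪g, h⟫‖ ^ 2 - ε * ‖h‖ ^ 2) :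
    ∀ α : ℝ, ∀ u w : EuclideanSpace ℂ (Fin n),
      u = h - ((α : ℂ) * (⟪g, h⟫ / ((‖g‖ : ℂ) ^ 2))) • g →
      w = ‖u‖⁻¹ • u →
      (‖⟪g, w⟫‖ ^ 2 = ε ↔ ζ * (1 - α) ^ 2 = ζ - η) := by
  intro α u w hu hw
  have hG : ‖g‖ ≠ 0 := norm_ne_zero_iff.mpr hg
  have hGc : (‖g‖ : ℂ) ≠ 0 := by exact_mod_cast hG
  have hu0 : u ≠ 0 := by
    intro h0
    have hp := LinearIndependent.pair_iff.mp hind 1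
      (-((α : ℂ) * (⟪g, h⟫ / ((‖g‖ : ℂ) ^ 2)))) (by
        rw [one_smul, neg_smul, ← sub_eq_add_neg, ← hu, h0])
    exact one_ne_zero hp.1
  have hU : ‖u‖ ≠ 0 := norm_ne_zero_iff.mpr hu0
  have hin : ⟪g, u⟫ = ((1 - α : ℝ) : ℂ) * ⟪g, h⟫ := by
    rw [hu, inner_sub_right, inner_smul_right, inner_self_eq_norm_sq_to_K]
    push_cast
    simp only [Complex.coe_algebraMap]
    field_simp
  have hgu : ‖⟪g, u⟫‖ ^ 2 = (1 - α) ^ 2 * ‖⟪g, h⟫‖ ^ 2 := by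
    rw [hin, norm_mul, mul_pow, Complex.norm_real, Real.norm_eq_abs, sq_abs]
  have hw2 : ‖⟪g, w⟫‖ ^ 2 = (1 - α) ^ 2 * ‖⟪g, h⟫‖ ^ 2 / ‖u‖ ^ 2 := by
    have : w = ((‖u‖⁻¹ : ℝ) : ℂ) • u := by rw [hw]; exact (Complex.coe_smul _ _).symm
    rw [this, inner_smul_right, norm_mul, mul_pow, hgu, Complex.norm_real, norm_inv, norm_norm]
    field_simp
  have hcross : ((α : ℂ) * (⟪g, h⟫ / ((‖g‖ : ℂ) ^ 2))) * ⟪h, g⟫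
      = ((α * ‖⟪g, h⟫‖ ^ 2 / ‖g‖ ^ 2 : ℝ) : ℂ) := by
    rw [← inner_conj_symm h g]
    have := Complex.mul_conj' ⟪g, h⟫
    push_cast
    rw [← this]
    ring
  have hnu : ‖u‖ ^ 2 = ‖h‖ ^ 2 - 2 * (α * ‖⟪g, h⟫‖ ^ 2 / ‖g‖ ^ 2)
      + α ^ 2 * ‖⟪g, h⟫‖ ^ 2 / ‖g‖ ^ 2 := by
    rw [hu, @norm_sub_sq ℂ, inner_smul_right, hcross, norm_smul, norm_mul, norm_div, norm_pow,
      Complex.norm_real, Complex.norm_real, norm_norm, mul_pow, mul_pow, Real.norm_eq_abs, sq_abs]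
    simp only [RCLike.re_to_complex, Complex.ofReal_re]
    field_simp
  rw [hw2, div_eq_iff (pow_ne_zero 2 hU), hnu, hζ, hη]
  constructor
  · intro e
    linear_combination e
  · intro e
    linear_combination e
end

section
/- Let h, g be vectors in EuclideanSpace ℂ (Fin n) and let ε > 0 be a real number. Then there exists w* ∈ EuclideanSpace ℂ (Fin n) lying in the ℂ-linear span of {h, g} such that ‖w*‖ ≤ 1, ‖⟪g,w*⟫‖² ≤ ε, and for every w ∈ EuclideanSpace ℂ (Fin n) with ‖w‖ ≤ 1 and ‖⟪g,w⟫‖² ≤ ε, one has ‖⟪h,w⟫‖² ≤ ‖⟪h,w*⟫‖². -/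
open scoped InnerProductSpace

local notation "⟪" x ", " y "⟫" => @inner ℂ _ _ x y

theorem exists_optimal_beamformer_in_span {n : ℕ} (h g : EuclideanSpace ℂ (Fin n))
    (ε : ℝ) (hε : 0 < ε) :
    ∃ wstar : EuclideanSpace ℂ (Fin n),
      wstar ∈ Submodule.span ℂ ({h, g} : Set (EuclideanSpace ℂ (Fin n))) ∧
      ‖wstar‖ ≤ 1 ∧ ‖⟪g, wstar⟫‖ ^ 2 ≤ ε ∧
      ∀ w : EuclideanSpace ℂ (Fin n), ‖w‖ ≤ 1 → ‖⟪g, w⟫‖ ^ 2 ≤ ε →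
        ‖⟪h, w⟫‖ ^ 2 ≤ ‖⟪h, wstar⟫‖ ^ 2 := by
  have hcomp : IsCompact {w : EuclideanSpace ℂ (Fin n) | ‖w‖ ≤ 1 ∧ ‖⟪g, w⟫‖ ^ 2 ≤ ε} := by
    refine (isCompact_closedBall (0 : EuclideanSpace ℂ (Fin n)) 1).of_isClosed_subset ?_ ?_
    · rw [Set.setOf_and]
      apply IsClosed.inter
      · apply isClosed_le <;> fun_prop
      · apply isClosed_le <;> fun_prop
    · intro w hw
      simpa using hw.1
  obtain ⟨w0, ⟨h1, h2⟩, hmax⟩ := hcomp.exists_isMaxOn (f := fun w => ‖⟪h, w⟫‖ ^ 2)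
    ⟨0, by simp, by simpa using hε.le⟩ (by fun_prop)
  let K := Submodule.span ℂ ({h, g} : Set (EuclideanSpace ℂ (Fin n)))
  have key : ∀ x ∈ K, ⟪x, K.starProjection w0⟫ = ⟪x, w0⟫ := by
    intro x hx
    rw [← Submodule.inner_starProjection_left_eq_right,
      Submodule.starProjection_eq_self_iff.2 hx]
  have kh := key h (Submodule.subset_span (by simp))
  have kg := key g (Submodule.subset_span (by simp))
  refine ⟨K.starProjection w0, Submodule.starProjection_apply_mem K w0,
    (K.norm_starProjection_apply_le w0).trans h1, by rw [kg]; exact h2, ?_⟩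
  intro w hw1 hw2
  rw [kh]
  exact hmax ⟨hw1, hw2⟩
end
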